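/- arXiv:1005.1984 — 2 statements merged into one kernel-verified Lean document; each statement's English description precedes it below -/
import Mathlib

section
/- For every prime number p there exist x, y, z ∈ ℚ_p, not all zero, with x⁴ − 17z⁴ = 2(y² + 4z²)², and there exist x, y, z ∈ ℝ, not all zero, with x⁴ − 17z⁴ = 2(y² + 4z²)². -/
section LocalLifting

/-- Hensel's lemma for `n`-th roots. -/
theorem PadicInt.exists_pow_eq_of_toZMod {p : ℕ} [Fact p.Prime] {n : ℕ} (hn : (n : ZMod p) ≠ 0)
    {c : ℤ_[p]} {a : ZMod p} (ha : a ≠ 0) (hac : a ^ n = PadicInt.toZMod c) :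
    ∃ x : ℤ_[p], x ^ n = c ∧ PadicInt.toZMod x = a := by
  have norm_lt : ∀ x : ℤ_[p], ‖x‖ < 1 ↔ PadicInt.toZMod x = 0 := fun x => by
    rw [← RingHom.mem_ker, PadicInt.ker_toZMod, IsLocalRing.mem_maximalIdeal,
      PadicInt.mem_nonunits]
  obtain ⟨b, rfl⟩ := ZMod.ringHom_surjective (PadicInt.toZMod (p := p)) a
  set F : Polynomial ℤ_[p] := Polynomial.X ^ n - Polynomial.C c with hF
  have hF' : ‖F.derivative.aeval b‖ = 1 := by
    refine le_antisymm (PadicInt.norm_le_one _) (not_lt.1 fun h => ?_)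
    rw [norm_lt] at h
    rw [hF, Polynomial.derivative_sub, Polynomial.derivative_X_pow, Polynomial.derivative_C] at h
    simp [hn] at h
    exact ha h.1
  have hFb : ‖F.aeval b‖ < 1 := by
    rw [norm_lt]
    simp [hF, hac]
  obtain ⟨x, hx, hxb, -⟩ := hensels_lemma (F := F) (a := b) (by rw [hF']; simpa using hFb)
  refine ⟨x, ?_, ?_⟩
  · simpa [hF, sub_eq_zero] using hx
  · rw [hF', norm_lt] at hxb
    simpa [sub_eq_zero] using hxb

theorem PadicInt.exists_sq_eq_neg_seven : ∃ x : ℤ_[2], x ^ 2 = -7 := by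
  set F : Polynomial ℤ_[2] := Polynomial.X ^ 2 + Polynomial.C 7 with hF
  have h2 : ‖(2 : ℤ_[2])‖ = 2⁻¹ := by simpa using PadicInt.norm_p (p := 2)
  have h1 : F.aeval (1 : ℤ_[2]) = 2 ^ 3 := by simp [hF]; norm_num
  have h3 : F.derivative.aeval (1 : ℤ_[2]) = 2 := by
    simp [hF]; norm_num
  obtain ⟨x, hx, -⟩ := hensels_lemma (F := F) (a := (1 : ℤ_[2])) (by
    rw [h1, h3, norm_pow, h2]; norm_num)
  refine ⟨x, ?_⟩
  simp [hF] at hx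
  linear_combination hx

/-- A point modulo `p` with `x ≠ 0` lifts to a `p`-adic point. -/
theorem exists_padic_point_of_zmod {p : ℕ} [Fact p.Prime] (hp : p ≠ 2) {x y z : ZMod p}
    (hx : x ≠ 0) (h : x ^ 4 = 17 * z ^ 4 + 2 * (y ^ 2 + 4 * z ^ 2) ^ 2) :
    ∃ x y z : ℚ_[p], ¬(x = 0 ∧ y = 0 ∧ z = 0) ∧
      x ^ 4 - 17 * z ^ 4 = 2 * (y ^ 2 + 4 * z ^ 2) ^ 2 := by
  have h2 : (2 : ZMod p) ≠ 0 := Ring.two_ne_zero (by rwa [ZMod.ringChar_zmod_n])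
  have h4 : ((4 : ℕ) : ZMod p) ≠ 0 := by
    have : ((4 : ℕ) : ZMod p) = 2 * 2 := by norm_num
    rw [this]; exact mul_ne_zero h2 h2
  obtain ⟨y, rfl⟩ := ZMod.ringHom_surjective (PadicInt.toZMod (p := p)) y
  obtain ⟨z, rfl⟩ := ZMod.ringHom_surjective (PadicInt.toZMod (p := p)) z
  obtain ⟨w, hw, hwx⟩ := PadicInt.exists_pow_eq_of_toZMod h4 hx
    (c := 17 * z ^ 4 + 2 * (y ^ 2 + 4 * z ^ 2) ^ 2) (by
      simpa only [map_add, map_mul, map_pow, map_ofNat] using h)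
  refine ⟨w, y, z, fun ⟨h0, _⟩ => hx ?_, ?_⟩
  · rw [← hwx, show w = 0 from Subtype.ext h0, map_zero]
  · have := congrArg (PadicInt.Coe.ringHom (p := p)) hw
    simp only [map_add, map_mul, map_pow, map_ofNat] at this
    exact sub_eq_of_eq_add' this

theorem exists_padic_point_two :
    ∃ x y z : ℚ_[2], ¬(x = 0 ∧ y = 0 ∧ z = 0) ∧
      x ^ 4 - 17 * z ^ 4 = 2 * (y ^ 2 + 4 * z ^ 2) ^ 2 := by
  obtain ⟨x, hx⟩ := PadicInt.exists_sq_eq_neg_seven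
  have hx' := congrArg (PadicInt.Coe.ringHom (p := 2)) hx
  simp only [map_pow, map_neg, map_ofNat] at hx'
  exact ⟨PadicInt.Coe.ringHom x, 0, 1, by simp,
    by linear_combination (PadicInt.Coe.ringHom x ^ 2 - 7) * hx'⟩

instance fact_prime_five : Fact (Nat.Prime 5) := ⟨by norm_num⟩

theorem exists_padic_point_five :
    ∃ x y z : ℚ_[5], ¬(x = 0 ∧ y = 0 ∧ z = 0) ∧
      x ^ 4 - 17 * z ^ 4 = 2 * (y ^ 2 + 4 * z ^ 2) ^ 2 := by
  obtain ⟨r, hr, hr2⟩ := PadicInt.exists_pow_eq_of_toZMod (p := 5) (n := 2) (c := -136) (a := 2)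
    (by decide) (by decide) (by simp only [map_neg, map_ofNat]; decide)
  obtain ⟨y, hy, -⟩ := PadicInt.exists_pow_eq_of_toZMod (p := 5) (n := 2) (c := r - 16) (a := 1)
    (by decide) (by decide) (by simp only [map_sub, map_ofNat, hr2]; decide)
  have hr' := congrArg (PadicInt.Coe.ringHom (p := 5)) hr
  have hy' := congrArg (PadicInt.Coe.ringHom (p := 5)) hy
  simp only [map_pow, map_neg, map_sub, map_ofNat] at hr' hy'
  refine ⟨0, PadicInt.Coe.ringHom y, 2, by simp, ?_⟩
  rw [hy']
  linear_combination (-2) * hr'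

end LocalLifting

section CharacterSums

open Finset

variable {F : Type*} [Field F] [Fintype F] [DecidableEq F]

local notation "χ" => quadraticChar F

theorem sum_ite_sq_eq (hF : ringChar F ≠ 2) (a : F) :
    ∑ x : F, (if x ^ 2 = a then (1 : ℤ) else 0) = χ a + 1 := by
  rw [← quadraticChar_card_sqrts hF a, Finset.sum_boole]
  congr 2
  ext x; simp

theorem sum_comp_sq (hF : ringChar F ≠ 2) (f : F → ℤ) :
    ∑ x : F, f (x ^ 2) = ∑ c : F, f c * (χ c + 1) := by
  simp_rw [← sum_ite_sq_eq hF, Finset.mul_sum]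
  rw [Finset.sum_comm]
  simp

theorem quadraticChar_mul_self {a : F} (ha : a ≠ 0) : χ a * χ a = 1 := by
  rw [← sq, quadraticChar_sq_one ha]

theorem abs_quadraticChar_le_one (a : F) : |χ a| ≤ 1 := by
  by_cases ha : a = 0
  · simp [ha]
  · rcases quadraticChar_dichotomy ha with h | h <;> simp [h]

theorem sum_quadraticChar_add_mul_add (hF : ringChar F ≠ 2) (s t : F) :
    ∑ a : F, χ (a + s) * χ (a + t) = (if s = t then (Fintype.card F : ℤ) else 0) - 1 := by
  split_ifs with h
  · subst h
    rw [← Equiv.sum_comp (Equiv.subRight s)]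
    simp only [Equiv.subRight_apply, sub_add_cancel]
    have : ∀ a : F, χ a * χ a = 1 - if a = 0 then 1 else 0 := fun a => by
      split_ifs with ha
      · simp [ha]
      · rw [quadraticChar_mul_self ha, sub_zero]
    simp only [this, Finset.sum_sub_distrib, Finset.sum_ite_eq', Finset.mem_univ, if_true]
    simp
  · have hd : s - t ≠ 0 := sub_ne_zero.2 h
    have hJ := jacobiSum_nontrivial_inv (quadraticChar_ne_one hF)
    rw [(quadraticChar_isQuadratic F).inv, jacobiSum] at hJ
    rw [← Equiv.sum_comp ((Equiv.mulLeft₀ (s - t) hd).trans (Equiv.subRight s))]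
    have : ∀ x : F, χ ((s - t) * x - s + s) * χ ((s - t) * x - s + t)
        = χ (-1) * (χ x * χ (1 - x)) := fun x => by
      rw [show (s - t) * x - s + s = (s - t) * x by ring,
        show (s - t) * x - s + t = (s - t) * (-1) * (1 - x) by ring]
      simp only [map_mul]
      linear_combination (χ (-1) * χ x * χ (1 - x)) * quadraticChar_mul_self hd
    simp only [Equiv.trans_apply, Equiv.mulLeft₀_apply, Equiv.subRight_apply, this]
    rw [← Finset.mul_sum, hJ]
    linear_combination - quadraticChar_mul_self (F := F) (a := -1) (by simp)

theorem sum_quadraticChar_sq_add (hF : ringChar F ≠ 2) {e : F} (he : e ≠ 0) :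
    ∑ w : F, χ (w ^ 2 + e) = -1 := by
  rw [sum_comp_sq hF (fun c => χ (c + e))]
  have h := sum_quadraticChar_add_mul_add hF e 0
  have h' := quadraticChar_sum_zero (F := F) hF
  rw [← Equiv.sum_comp (Equiv.addRight e)] at h'
  simp only [he, if_false, add_zero, Equiv.coe_addRight] at h h'
  simp only [mul_add, mul_one, Finset.sum_add_distrib, h, h']
  norm_num

/-- The trace-like sum of the curve `y² = u (u² + a u + b)`. -/
def cubicSum (a b : F) : ℤ := ∑ u : F, χ u * χ (u ^ 2 + a * u + b)

theorem cubicSum_neg (h : χ (-1) = 1) (a b : F) :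
    cubicSum (-a) b = cubicSum a b := by
  unfold cubicSum
  rw [← Equiv.sum_comp (Equiv.neg F)]
  refine Finset.sum_congr rfl fun u _ => ?_
  simp only [Equiv.neg_apply]
  rw [show -u = -1 * u by ring, map_mul, h]
  ring_nf

theorem cubicSum_mul_sq {t : F} (ht : t ≠ 0) (b : F) :
    cubicSum 0 (b * t ^ 2) = χ t * cubicSum 0 b := by
  unfold cubicSum
  rw [← Equiv.sum_comp (Equiv.mulLeft₀ t ht), Finset.mul_sum]
  refine Finset.sum_congr rfl fun u _ => ?_
  rw [Equiv.mulLeft₀_apply, show (t * u) ^ 2 + 0 * (t * u) + b * t ^ 2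
    = t ^ 2 * (u ^ 2 + 0 * u + b) by ring, map_mul, map_mul, quadraticChar_sq_one' ht]
  ring

/-- The second moment of `cubicSum 0 b` over `b`. -/
theorem sum_cubicSum_zero_sq_le (hF : ringChar F ≠ 2) :
    ∑ b : F, cubicSum 0 b ^ 2 ≤ 2 * Fintype.card F * (Fintype.card F - 1 : ℤ) := by
  set q : ℤ := ((Fintype.card F : ℕ) : ℤ)
  have h0 := quadraticChar_sum_zero (F := F) hF
  have hq : (0 : ℤ) ≤ q := by positivity
  calc ∑ b : F, cubicSum 0 b ^ 2
      = ∑ u : F, ∑ v : F, χ u * χ v * ∑ b : F, χ (b + u ^ 2) * χ (b + v ^ 2) := by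
        simp only [cubicSum, sq (∑ u : F, _), Finset.sum_mul_sum, zero_mul, add_zero]
        rw [Finset.sum_comm]
        refine Finset.sum_congr rfl fun u _ => ?_
        rw [Finset.sum_comm]
        refine Finset.sum_congr rfl fun v _ => ?_
        rw [Finset.mul_sum]
        refine Finset.sum_congr rfl fun b _ => ?_
        rw [add_comm b, add_comm b]; ring
    _ = ∑ u : F, ∑ v : F, ((χ u * χ v) * (if u ^ 2 = v ^ 2 then q else 0) - χ u * χ v) := by
        simp only [sum_quadraticChar_add_mul_add hF, mul_sub, mul_one, q]
    _ = ∑ u : F, ∑ v : F, (χ u * χ v) * (if u ^ 2 = v ^ 2 then q else 0) := by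
        simp only [Finset.sum_sub_distrib]
        rw [← Finset.sum_mul_sum, h0]; ring
    _ ≤ ∑ u : F, if u = 0 then 0 else 2 * q := by
        refine Finset.sum_le_sum fun u _ => ?_
        split_ifs with hu
        · simp [hu]
        · calc ∑ v : F, (χ u * χ v) * (if u ^ 2 = v ^ 2 then q else 0)
              ≤ ∑ v : F, q * (if v ^ 2 = u ^ 2 then (1 : ℤ) else 0) := by
                refine Finset.sum_le_sum fun v _ => ?_
                have : χ u * χ v ≤ 1 := by
                  rw [← map_mul]; exact (abs_le.1 (abs_quadraticChar_le_one _)).2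
                by_cases h : v ^ 2 = u ^ 2
                · simp only [h, if_true]; nlinarith
                · simp [h, Ne.symm h]
            _ = 2 * q := by
                rw [← Finset.mul_sum, sum_ite_sq_eq hF, quadraticChar_sq_one' hu]; ring
    _ = 2 * q * (q - 1) := by
        have : ∀ u : F, (if u = 0 then 0 else 2 * q) = 2 * q - if u = 0 then 2 * q else 0 :=
          fun u => by split_ifs <;> ring
        simp only [this, Finset.sum_sub_distrib, Finset.sum_ite_eq', Finset.mem_univ, if_true,
          Finset.sum_const, Finset.card_univ, nsmul_eq_mul]
        ring

/-- The Hasse bound for the curves `y² = u (u² + b)`. -/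
theorem cubicSum_zero_sq_le (hF : ringChar F ≠ 2) {b : F} (hb : b ≠ 0) :
    cubicSum 0 b ^ 2 ≤ 4 * Fintype.card F := by
  have h1 : ∑ t : F, cubicSum 0 (b * t ^ 2) ^ 2 ≤ 2 * ∑ c : F, cubicSum 0 c ^ 2 := by
    rw [sum_comp_sq hF (fun c => cubicSum 0 (b * c) ^ 2),
      ← Equiv.sum_comp (Equiv.mulLeft₀ b hb) (fun c => cubicSum 0 c ^ 2), Finset.mul_sum]
    refine Finset.sum_le_sum fun c _ => ?_
    have := (abs_le.1 (abs_quadraticChar_le_one c)).2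
    rw [Equiv.mulLeft₀_apply]
    nlinarith [sq_nonneg (cubicSum 0 (b * c))]
  have h2 : (Fintype.card F - 1 : ℤ) * cubicSum 0 b ^ 2 ≤ ∑ t : F, cubicSum 0 (b * t ^ 2) ^ 2 := by
    calc (Fintype.card F - 1 : ℤ) * cubicSum 0 b ^ 2
        = ∑ t : F, if t = 0 then 0 else cubicSum 0 b ^ 2 := by
          have : ∀ t : F, (if t = 0 then 0 else cubicSum 0 b ^ 2)
              = cubicSum 0 b ^ 2 - if t = 0 then cubicSum 0 b ^ 2 else 0 :=
            fun t => by split_ifs <;> ring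
          simp only [this, Finset.sum_sub_distrib, Finset.sum_ite_eq', Finset.mem_univ, if_true,
            Finset.sum_const, Finset.card_univ, nsmul_eq_mul]
          ring
      _ ≤ _ := by
          refine Finset.sum_le_sum fun t _ => ?_
          split_ifs with ht
          · positivity
          · rw [cubicSum_mul_sq ht, mul_pow, quadraticChar_sq_one ht, one_mul]
  have h3 := sum_cubicSum_zero_sq_le hF
  have h4 : (1 : ℤ) < Fintype.card F := by exact_mod_cast Fintype.one_lt_card
  nlinarith

/-- The second moment of `cubicSum a b` over `a`. -/
theorem sum_cubicSum_sq_le (hF : ringChar F ≠ 2) (b : F) :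
    ∑ a : F, cubicSum a b ^ 2 ≤ (Fintype.card F : ℤ) ^ 2 - 1 := by
  set q : ℤ := ((Fintype.card F : ℕ) : ℤ)
  have hq : (0 : ℤ) ≤ q := by positivity
  have key : ∀ a u : F, χ u * χ (u ^ 2 + a * u + b)
      = (if u = 0 then 0 else 1) * χ (a + (u + b / u)) := fun a u => by
    split_ifs with hu
    · simp [hu]
    · rw [show u ^ 2 + a * u + b = u * (a + (u + b / u)) by field_simp; ring, map_mul, ← mul_assoc,
        quadraticChar_mul_self hu]
  have hone : ∑ u : F, (if u = 0 then (0 : ℤ) else 1) = q - 1 := by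
    have : ∀ u : F, (if u = 0 then (0 : ℤ) else 1) = 1 - if u = 0 then 1 else 0 :=
      fun u => by split_ifs <;> ring
    simp [this, q]
  calc ∑ a : F, cubicSum a b ^ 2
      = ∑ u : F, ∑ v : F, (if u = 0 then 0 else 1) * (if v = 0 then 0 else 1) *
          ∑ a : F, χ (a + (u + b / u)) * χ (a + (v + b / v)) := by
        simp only [cubicSum, key, sq (∑ u : F, _), Finset.sum_mul_sum]
        rw [Finset.sum_comm]
        refine Finset.sum_congr rfl fun u _ => ?_
        rw [Finset.sum_comm]
        refine Finset.sum_congr rfl fun v _ => ?_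
        rw [Finset.mul_sum]
        refine Finset.sum_congr rfl fun a _ => ?_
        ring
    _ = ∑ u : F, ∑ v : F, ((if u = 0 then 0 else 1) * (if v = 0 then 0 else 1) *
          (if u + b / u = v + b / v then q else 0)
          - (if u = 0 then 0 else 1) * (if v = 0 then 0 else 1)) := by
        simp only [sum_quadraticChar_add_mul_add hF, mul_sub, mul_one, q]
    _ = ∑ u : F, ∑ v : F, (if u = 0 then 0 else 1) * (if v = 0 then 0 else 1) *
          (if u + b / u = v + b / v then q else 0) - (q - 1) ^ 2 := by
        simp only [Finset.sum_sub_distrib]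
        rw [← Finset.sum_mul_sum, hone, sq]
    _ ≤ ∑ u : F, (if u = 0 then 0 else 1) * (2 * q) - (q - 1) ^ 2 := by
        refine sub_le_sub_right (Finset.sum_le_sum fun u _ => ?_) _
        split_ifs with hu
        · simp
        · calc ∑ v : F, 1 * (if v = 0 then 0 else 1) *
                  (if u + b / u = v + b / v then q else 0)
              ≤ ∑ v : F, ((if v = u then q else 0) + (if v = b / u then q else 0)) := by
                refine Finset.sum_le_sum fun v _ => ?_
                have hpos : 0 ≤ (if v = u then q else 0) + (if v = b / u then q else 0) := by
                  split_ifs <;> linarith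
                by_cases hv : v = 0
                · simpa [hv] using hpos
                by_cases h : u + b / u = v + b / v
                · have h' : (v - u) * (v - b / u) = 0 := by
                    field_simp at h ⊢
                    linear_combination -h
                  rcases mul_eq_zero.1 h' with h' | h' <;> rw [sub_eq_zero] at h'
                  · simp only [h, h', if_true]
                    split_ifs <;> linarith
                  · simp only [hv, h, if_true, if_false]
                    rw [if_pos h']
                    split_ifs <;> linarith
                · simpa [h] using hpos
            _ = 1 * (2 * q) := by
                simp only [Finset.sum_add_distrib, Finset.sum_ite_eq', Finset.mem_univ, if_true]
                ring
    _ = q ^ 2 - 1 := by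
        rw [← Finset.sum_mul, hone]; ring

theorem two_mul_cubicSum_sq_le (hF : ringChar F ≠ 2) (h : χ (-1) = 1) {a b : F} (ha : a ≠ 0) :
    2 * cubicSum a b ^ 2 ≤ (Fintype.card F : ℤ) ^ 2 - 1 := by
  refine le_trans ?_ (sum_cubicSum_sq_le hF b)
  have hne : a ≠ -a := fun h' => ha ((Ring.eq_self_iff_eq_zero_of_char_ne_two hF).1 h'.symm)
  rw [two_mul]
  nth_rewrite 2 [← cubicSum_neg h]
  rw [← Finset.sum_pair (f := fun c => cubicSum c b ^ 2) hne]
  exact Finset.sum_le_sum_of_subset_of_nonneg (Finset.subset_univ _) fun _ _ _ => sq_nonneg _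

/-- Indicator function of the affine conic `X² = 2 (Y + 4)² + 17`. -/
def conicIndicator (X Y : F) : ℤ := if X ^ 2 = 2 * Y ^ 2 + 16 * Y + 49 then 1 else 0

theorem sum_conicIndicator_left (hF : ringChar F ≠ 2) (Y : F) :
    ∑ X : F, conicIndicator X Y = χ 2 * χ (Y ^ 2 + 8 * Y + 49 / 2) + 1 := by
  have h2 : (2 : F) ≠ 0 := Ring.two_ne_zero hF
  unfold conicIndicator
  rw [sum_ite_sq_eq hF, ← map_mul]
  congr 2
  field_simp
  ring

theorem sum_conicIndicator_right (hF : ringChar F ≠ 2) (X : F) :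
    ∑ Y : F, conicIndicator X Y = χ 2 * χ (X ^ 2 + 0 * X + -17) + 1 := by
  have h2 : (2 : F) ≠ 0 := Ring.two_ne_zero hF
  have h : ∀ Y : F, conicIndicator X Y
      = if (Y + 4) ^ 2 = 2 * (X ^ 2 + 0 * X + -17) / 2 ^ 2 then 1 else 0 := fun Y => by
    unfold conicIndicator
    congr 1
    rw [eq_div_iff (pow_ne_zero 2 h2), eq_iff_iff]
    constructor <;> intro h
    · linear_combination -2 * h
    · refine mul_left_cancel₀ h2 ?_
      linear_combination -h
  simp only [h]
  refine (Equiv.sum_comp (Equiv.addRight (4 : F))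
    (fun Y => if Y ^ 2 = 2 * (X ^ 2 + 0 * X + -17) / 2 ^ 2 then (1 : ℤ) else 0)).trans ?_
  rw [sum_ite_sq_eq hF, div_eq_mul_inv, map_mul, map_mul, ← inv_pow,
    quadraticChar_sq_one' (inv_ne_zero h2), mul_one]

theorem sum_sum_conicIndicator (hF : ringChar F ≠ 2) (h17 : (17 : F) ≠ 0) :
    ∑ Y : F, ∑ X : F, conicIndicator X Y = Fintype.card F - χ 2 := by
  have h2 : (2 : F) ≠ 0 := Ring.two_ne_zero hF
  have h := sum_quadraticChar_sq_add hF (div_ne_zero h17 h2)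
  rw [← Equiv.sum_comp (Equiv.addRight (4 : F))] at h
  have h' : ∀ Y : F, Y ^ 2 + 8 * Y + 49 / 2 = (Equiv.addRight (4 : F)) Y ^ 2 + 17 / 2 := fun Y => by
    rw [Equiv.coe_addRight]; field_simp; ring
  simp only [sum_conicIndicator_left hF, h', Finset.sum_add_distrib, ← Finset.mul_sum, h]
  simp
  ring

theorem sum_quadraticChar_mul_conicIndicator_left (hF : ringChar F ≠ 2) :
    ∑ Y : F, ∑ X : F, χ X * conicIndicator X Y = χ 2 * cubicSum (0 : F) (-17) := by
  rw [Finset.sum_comm]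
  simp only [← Finset.mul_sum, sum_conicIndicator_right hF, mul_add, mul_one,
    Finset.sum_add_distrib, quadraticChar_sum_zero hF, cubicSum, add_zero]
  rw [Finset.mul_sum]
  exact Finset.sum_congr rfl fun _ _ => by ring

theorem sum_quadraticChar_mul_conicIndicator_right (hF : ringChar F ≠ 2) :
    ∑ Y : F, ∑ X : F, χ Y * conicIndicator X Y = χ 2 * cubicSum (8 : F) (49 / 2) := by
  simp only [← Finset.mul_sum, sum_conicIndicator_left hF, mul_add, mul_one,
    Finset.sum_add_distrib, quadraticChar_sum_zero hF, cubicSum, add_zero]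
  rw [Finset.mul_sum]
  exact Finset.sum_congr rfl fun _ _ => by ring

theorem sum_quadraticChar_mul_mul_conicIndicator (hF : ringChar F ≠ 2) (h7 : (7 : F) ≠ 0) :
    ∑ Y : F, ∑ X : F, χ X * χ Y * conicIndicator X Y
      = cubicSum (0 : F) (-34 / 49) - ∑ X : F, χ X * (if X ^ 2 = 2 then 1 else 0) := by
  have h49 : (49 : F) ≠ 0 := by
    rw [show (49 : F) = 7 ^ 2 by norm_num]; exact pow_ne_zero 2 h7
  set G : F → ℤ := fun Z => ∑ X : F, χ X * (if X ^ 2 = 2 + 16 * Z + 49 * Z ^ 2 then 1 else 0)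
  have h1 : ∀ Y : F, ∑ X : F, χ X * χ Y * conicIndicator X Y
      = G (Y⁻¹) - if Y⁻¹ = 0 then G 0 else 0 := fun Y => by
    by_cases hY : Y = 0
    · simp [hY]
    rw [if_neg (inv_ne_zero hY), sub_zero, ← Equiv.sum_comp (Equiv.mulRight₀ Y hY)]
    refine Finset.sum_congr rfl fun X _ => ?_
    simp only [Equiv.mulRight₀_apply, map_mul, conicIndicator]
    rw [mul_assoc (χ X), quadraticChar_mul_self hY, mul_one]
    congr 2
    rw [eq_iff_iff]
    constructor <;> intro h
    · field_simp
      linear_combination h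
    · field_simp at h
      linear_combination h
  have h2 : ∑ Z : F, G Z = cubicSum (0 : F) (-34 / 49) := by
    simp only [G]
    rw [Finset.sum_comm]
    have h : ∀ X Z : F, (X ^ 2 = 2 + 16 * Z + 49 * Z ^ 2) =
        ((Z + 8 / 49) ^ 2 = (X ^ 2 + 0 * X + -34 / 49) / 7 ^ 2) := fun X Z => by
      rw [eq_div_iff (pow_ne_zero 2 h7), eq_iff_iff]
      have e : (Z + 8 / 49) ^ 2 * 7 ^ 2 - (X ^ 2 + 0 * X + -34 / 49)
          = 2 + 16 * Z + 49 * Z ^ 2 - X ^ 2 := by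
        field_simp; ring
      rw [← sub_eq_zero (b := X ^ 2 + 0 * X + -34 / 49), e, sub_eq_zero, eq_comm]
    have h' : ∀ X : F, ∑ Z : F, (if X ^ 2 = 2 + 16 * Z + 49 * Z ^ 2 then (1 : ℤ) else 0)
        = χ (X ^ 2 + 0 * X + -34 / 49) + 1 := fun X => by
      simp only [h]
      refine (Equiv.sum_comp (Equiv.addRight (8 / 49 : F))
        (fun Z => if Z ^ 2 = (X ^ 2 + 0 * X + -34 / 49) / 7 ^ 2 then (1 : ℤ) else 0)).trans ?_
      rw [sum_ite_sq_eq hF, div_eq_mul_inv _ ((7 : F) ^ 2), map_mul, ← inv_pow,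
        quadraticChar_sq_one' (inv_ne_zero h7), mul_one]
    simp only [← Finset.mul_sum, h', mul_add, mul_one, Finset.sum_add_distrib,
      quadraticChar_sum_zero hF, cubicSum, add_zero]
  simp only [h1]
  rw [Function.Bijective.sum_comp inv_involutive.bijective (fun Z => G Z - if Z = 0 then G 0 else 0),
    Finset.sum_sub_distrib, h2, Finset.sum_ite_eq']
  simp [G]

/-- The bound comes from counting points `(X, Y)` of the conic with both coordinates squares:
`X = x²`, `Y = y²`. -/
theorem exists_fourth_power_eq (hF : ringChar F ≠ 2) (h : χ (-1) = 1) (h7 : (7 : F) ≠ 0)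
    (h17 : (17 : F) ≠ 0) (hq : 240 < Fintype.card F) :
    ∃ x y : F, x ≠ 0 ∧ x ^ 4 = 17 + 2 * (y ^ 2 + 4) ^ 2 := by
  by_contra! hne
  have h2 : (2 : F) ≠ 0 := Ring.two_ne_zero hF
  have h49 : (49 : F) ≠ 0 := by
    rw [show (49 : F) = 7 ^ 2 by norm_num]; exact pow_ne_zero 2 h7
  have hsq : ∀ a : F, a = 0 ∨ χ a = 1 → ∃ x, a = x ^ 2 := by
    rintro a (rfl | ha)
    · exact ⟨0, by simp⟩
    · have ha0 : a ≠ 0 := by rintro rfl; simp at ha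
      obtain ⟨x, hx⟩ := (quadraticChar_one_iff_isSquare ha0).1 ha
      exact ⟨x, by rw [hx, sq]⟩
  have hupper : ∑ Y : F, ∑ X : F, (1 + χ X) * (1 + χ Y) * conicIndicator X Y ≤ 4 := by
    calc ∑ Y : F, ∑ X : F, (1 + χ X) * (1 + χ Y) * conicIndicator X Y
        ≤ ∑ Y : F, ∑ X : F, if X = 0 then 2 * conicIndicator X Y else 0 := by
          refine Finset.sum_le_sum fun Y _ => Finset.sum_le_sum fun X _ => ?_
          have hY := abs_le.1 (abs_quadraticChar_le_one Y)
          unfold conicIndicator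
          by_cases hX : X = 0
          · simp only [hX, if_true, MulChar.map_zero]
            split_ifs <;> linarith
          rw [if_neg hX]
          split_ifs with hC
          swap
          · simp
          rcases quadraticChar_dichotomy hX with hX1 | hX1
          · have hY1 : χ Y = -1 := by
              by_contra hY1
              obtain ⟨x, rfl⟩ := hsq X (Or.inr hX1)
              obtain ⟨y, rfl⟩ := hsq Y (by
                by_cases hY0 : Y = 0
                · exact Or.inl hY0
                · exact Or.inr ((quadraticChar_dichotomy hY0).resolve_right hY1))
              exact hne x y (by rintro rfl; simp at hX) (by linear_combination hC)
            simp [hY1]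
          · simp [hX1]
      _ = 2 * (χ 2 * χ (0 ^ 2 + 0 * 0 + -17) + 1) := by
          simp only [Finset.sum_ite_eq', Finset.mem_univ, if_true, ← Finset.mul_sum,
            sum_conicIndicator_right hF]
      _ ≤ 4 := by
          rw [← map_mul]
          linarith [(abs_le.1 (abs_quadraticChar_le_one (2 * (0 ^ 2 + 0 * 0 + -17) : F))).2]
  have hexpand : ∑ Y : F, ∑ X : F, (1 + χ X) * (1 + χ Y) * conicIndicator X Y
      = (Fintype.card F - χ 2) + χ 2 * cubicSum (0 : F) (-17) + χ 2 * cubicSum (8 : F) (49 / 2)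
        + (cubicSum (0 : F) (-34 / 49) - ∑ X : F, χ X * (if X ^ 2 = 2 then 1 else 0)) := by
    rw [← sum_sum_conicIndicator hF h17, ← sum_quadraticChar_mul_conicIndicator_left hF,
      ← sum_quadraticChar_mul_conicIndicator_right hF,
      ← sum_quadraticChar_mul_mul_conicIndicator hF h7]
    simp only [← Finset.sum_add_distrib]
    exact Finset.sum_congr rfl fun Y _ => Finset.sum_congr rfl fun X _ => by ring
  have hT : ∑ X : F, χ X * (if X ^ 2 = 2 then 1 else 0) ≤ 2 := by
    calc ∑ X : F, χ X * (if X ^ 2 = 2 then 1 else 0)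
        ≤ ∑ X : F, if X ^ 2 = 2 then (1 : ℤ) else 0 := by
          refine Finset.sum_le_sum fun X _ => ?_
          have := (abs_le.1 (abs_quadraticChar_le_one X)).2
          split_ifs <;> linarith
      _ ≤ 2 := by
          rw [sum_ite_sq_eq hF]
          linarith [(abs_le.1 (abs_quadraticChar_le_one (2 : F))).2]
  have hχ2 : χ 2 * χ 2 = 1 := quadraticChar_mul_self h2
  have hχ2' := (abs_le.1 (abs_quadraticChar_le_one (2 : F))).2
  have hS₁ := cubicSum_zero_sq_le hF (neg_ne_zero.2 h17)
  have hS₂ := two_mul_cubicSum_sq_le hF h (a := (8 : F)) (b := 49 / 2)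
    (by rw [show (8 : F) = 2 ^ 3 by norm_num]; exact pow_ne_zero 3 h2)
  have hS₃ := cubicSum_zero_sq_le hF (b := (-34 / 49 : F)) (div_ne_zero
    (by rw [show (-34 : F) = -(2 * 17) by norm_num]; exact neg_ne_zero.2 (mul_ne_zero h2 h17)) h49)
  have hq' : (240 : ℤ) < Fintype.card F := by exact_mod_cast hq
  rw [hexpand] at hupper
  generalize (Fintype.card F : ℤ) = q at *
  have hlin : ∀ S : ℤ, S ^ 2 ≤ 4 * q → |16 * S| ≤ q + 256 := fun S hS =>
    abs_le_of_sq_le_sq (by nlinarith [sq_nonneg (q - 256)]) (by linarith)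
  have b₁ := (abs_le.1 (hlin (χ 2 * cubicSum (0 : F) (-17))
    (by rw [mul_pow, sq (χ 2), hχ2, one_mul]; exact hS₁))).1
  have b₃ := (abs_le.1 (hlin _ hS₃)).1
  have b₂ : |1000 * (χ 2 * cubicSum (8 : F) (49 / 2))| ≤ 708 * q := by
    refine abs_le_of_sq_le_sq ?_ (by linarith)
    rw [mul_pow, mul_pow, sq (χ 2), hχ2, one_mul]
    nlinarith
  have b₂' := (abs_le.1 b₂).1
  linarith

end CharacterSums

/-- The primes `p ≡ 1 mod 4` below the range of the character sum estimate, except `5`. -/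
theorem exists_small_point :
    ∀ p : Fin 241, p.val.Prime → p.val % 4 = 1 → p.val ≠ 5 → ∃ x : Fin 100, ∃ y : Fin 20,
      (x : ℕ) % p ≠ 0 ∧ (x : ℕ) ^ 4 % p = (17 + 2 * ((y : ℕ) ^ 2 + 4) ^ 2) % p := by
  decide +kernel

/-- The case `p ≡ 1 mod 4`. -/
theorem exists_zmod_point_of_mod_four_eq_one {p : ℕ} [Fact p.Prime] (hp4 : p % 4 = 1)
    (hp5 : p ≠ 5) : ∃ x y z : ZMod p, x ≠ 0 ∧ x ^ 4 = 17 * z ^ 4 + 2 * (y ^ 2 + 4 * z ^ 2) ^ 2 := by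
  have hp : p.Prime := Fact.out
  have hF : ringChar (ZMod p) ≠ 2 := by
    rw [ZMod.ringChar_zmod_n]; omega
  suffices ∃ x y : ZMod p, x ≠ 0 ∧ x ^ 4 = 17 + 2 * (y ^ 2 + 4) ^ 2 by
    obtain ⟨x, y, hx, h⟩ := this
    exact ⟨x, y, 1, hx, by rw [h]; ring⟩
  by_cases hle : p ≤ 240
  · obtain ⟨⟨x, _⟩, ⟨y, _⟩, hx, h⟩ := exists_small_point ⟨p, by omega⟩ hp hp4 hp5
    refine ⟨x, y, ?_, ?_⟩
    · rwa [Ne, ZMod.natCast_eq_zero_iff, Nat.dvd_iff_mod_eq_zero]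
    · exact_mod_cast (ZMod.natCast_eq_natCast_iff _ _ _).2 h
  · have hne : ∀ n : ℕ, 0 < n → n < 240 → (n : ZMod p) ≠ 0 := fun n h0 hn h => by
      rw [ZMod.natCast_eq_zero_iff] at h
      have := Nat.le_of_dvd h0 h
      omega
    refine exists_fourth_power_eq hF ?_ (by exact_mod_cast hne 7 (by norm_num) (by norm_num))
      (by exact_mod_cast hne 17 (by norm_num) (by norm_num)) (by rw [ZMod.card]; omega)
    rw [quadraticChar_one_iff_isSquare (by simp), FiniteField.isSquare_neg_one_iff, ZMod.card]
    omega

theorem exists_zmod_seven_point :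
    ∃ x y z : ZMod 7, x ≠ 0 ∧ x ^ 4 = 17 * z ^ 4 + 2 * (y ^ 2 + 4 * z ^ 2) ^ 2 :=
  ⟨2, 1, 0, by decide, by decide⟩

/-- The case `p ≡ 3 mod 4`: one of `7`, `-7` is a square. -/
theorem exists_zmod_point_of_mod_four_eq_three {p : ℕ} [Fact p.Prime] (hp4 : p % 4 = 3) :
    ∃ x y z : ZMod p, x ≠ 0 ∧ x ^ 4 = 17 * z ^ 4 + 2 * (y ^ 2 + 4 * z ^ 2) ^ 2 := by
  have hp : p.Prime := Fact.out
  by_cases hp7 : p = 7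
  · subst hp7
    exact exists_zmod_seven_point
  have h7 : (7 : ZMod p) ≠ 0 := fun h => hp7 <| by
    have : ((7 : ℕ) : ZMod p) = 0 := by exact_mod_cast h
    rw [ZMod.natCast_eq_zero_iff] at this
    exact (Nat.prime_dvd_prime_iff_eq hp (by norm_num)).1 this
  suffices ∃ x : ZMod p, x ^ 2 = 7 ∨ x ^ 2 = -7 by
    obtain ⟨x, hx⟩ := this
    refine ⟨x, 0, 1, ?_, ?_⟩
    · rintro rfl
      rcases hx with hx | hx
      · exact h7 (by simpa using hx.symm)
      · exact h7 (by simpa using hx.symm)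
    · rcases hx with hx | hx
      · linear_combination (x ^ 2 + 7) * hx
      · linear_combination (x ^ 2 - 7) * hx
  have hneg : quadraticChar (ZMod p) (-1) = -1 := by
    rw [quadraticChar_neg_one_iff_not_isSquare, FiniteField.isSquare_neg_one_iff, ZMod.card]
    omega
  rcases quadraticChar_dichotomy h7 with h | h
  · obtain ⟨x, hx⟩ := (quadraticChar_one_iff_isSquare h7).1 h
    exact ⟨x, Or.inl (by rw [hx, sq])⟩
  · obtain ⟨x, hx⟩ := (quadraticChar_one_iff_isSquare (neg_ne_zero.2 h7)).1
      (by rw [← neg_one_mul, map_mul, hneg, h]; norm_num)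
    exact ⟨x, Or.inr (by rw [hx, sq])⟩

/-- The Schinzel curve has points in every completion of ℚ:
nontrivial solutions of `x⁴ − 17z⁴ = 2(y² + 4z²)²` exist over every `ℚ_p` and over `ℝ`. -/
theorem schinzel_local_points :
    (∀ (p : ℕ) [Fact p.Prime],
      ∃ x y z : ℚ_[p], ¬(x = 0 ∧ y = 0 ∧ z = 0) ∧
        x ^ 4 - 17 * z ^ 4 = 2 * (y ^ 2 + 4 * z ^ 2) ^ 2) ∧
    (∃ x y z : ℝ, ¬(x = 0 ∧ y = 0 ∧ z = 0) ∧
      x ^ 4 - 17 * z ^ 4 = 2 * (y ^ 2 + 4 * z ^ 2) ^ 2) := by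
  constructor
  · intro p _
    have hp : p.Prime := Fact.out
    by_cases hp2 : p = 2
    · subst hp2
      exact exists_padic_point_two
    by_cases hp5 : p = 5
    · subst hp5
      exact exists_padic_point_five
    have hodd := hp.eq_two_or_odd
    obtain ⟨x, y, z, hx, h⟩ :
        ∃ x y z : ZMod p, x ≠ 0 ∧ x ^ 4 = 17 * z ^ 4 + 2 * (y ^ 2 + 4 * z ^ 2) ^ 2 := by
      rcases (by omega : p % 4 = 1 ∨ p % 4 = 3) with h4 | h4
      · exact exists_zmod_point_of_mod_four_eq_one h4 hp5
      · exact exists_zmod_point_of_mod_four_eq_three h4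
    exact exists_padic_point_of_zmod hp2 hx h
  · have h7 : √(7 : ℝ) ^ 2 = 7 := Real.sq_sqrt (by norm_num)
    exact ⟨√7, 0, 1, by simp, by linear_combination (√7 ^ 2 + 7) * h7⟩
end

section
/- Let K be a number field whose degree [K : ℚ] is odd. Then the only solution (x, y, z) ∈ K³ of the equation 2y² = x⁴ − 17z⁴ is (0, 0, 0). -/
open Polynomial in
/-- In an extension of odd degree, an element whose square lies in the base field
lies in the base field. -/
theorem exists_algebraMap_eq_of_sq_eq_of_odd_finrank {F L : Type*} [Field F] [Field L]
    [Algebra F L] [FiniteDimensional F L] (hodd : Odd (Module.finrank F L)) {y : L} {c : F}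
    (h : y ^ 2 = algebraMap F L c) : ∃ d : F, algebraMap F L d = y := by
  have hInt : IsIntegral F y := Algebra.IsIntegral.isIntegral y
  have hle : (minpoly F y).natDegree ≤ 2 := by
    have hdvd : minpoly F y ∣ (X ^ 2 - C c : F[X]) := minpoly.dvd F y (by simp [h])
    have hne : (X ^ 2 - C c : F[X]) ≠ 0 := X_pow_sub_C_ne_zero two_pos c
    simpa using natDegree_le_of_dvd hdvd hne
  have hodd' : Odd (minpoly F y).natDegree :=
    Odd.of_dvd_nat hodd (minpoly.degree_dvd hInt)
  have h1 : (minpoly F y).natDegree = 1 := by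
    obtain ⟨k, hk⟩ := hodd'
    omega
  have hdeg : (minpoly F y).degree = 1 := by
    rw [degree_eq_natDegree (minpoly.ne_zero hInt), h1]; rfl
  exact minpoly.mem_range_of_degree_eq_one F y hdeg

theorem Rat.two_mul_sq_ne_sq {a b : ℚ} (h : 2 * a ^ 2 = b ^ 2) : a = 0 := by
  by_contra ha
  have h2 : IsSquare (2 : ℚ) := ⟨b / a, by field_simp; linarith⟩
  exact absurd (Rat.isSquare_natCast_iff.mp (by exact_mod_cast h2 : IsSquare ((2 : ℕ) : ℚ)))
    Nat.prime_two.prime.irreducible.not_isSquare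

theorem ZMod.isSquare_natCast_of_forall_prime_dvd {m : ℕ} (n : ℕ)
    (h : ∀ p : ℕ, p.Prime → p ∣ n → IsSquare (p : ZMod m)) : IsSquare (n : ZMod m) := by
  induction n using induction_on_primes with
  | zero => simp
  | one => simp
  | prime_mul p a hp ih =>
    rw [Nat.cast_mul]
    exact (h p hp (dvd_mul_right _ _)).mul (ih fun q hq hqa => h q hq (hqa.mul_left p))

/-- The Reichardt–Lind equation has no solution in coprime integers. -/
theorem two_mul_sq_ne_of_isCoprime {x y z : ℤ} (hxz : IsCoprime x z) :
    2 * y ^ 2 ≠ x ^ 4 - 17 * z ^ 4 := by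
  intro h
  have h36 : ((2 : ℕ) : ZMod 17) = 6 * 6 := by decide
  have h0 : (17 : ZMod 17) = 0 := by decide
  have key : ∀ t x : ZMod 17, 2 * t ^ 4 = x ^ 4 → t = 0 ∧ x = 0 := by decide
  have h17 : Fact (Nat.Prime 17) := ⟨by norm_num⟩
  have hp : ∀ p : ℕ, p.Prime → p ∣ y.natAbs → IsSquare (p : ZMod 17) := by
    intro p hp hpy
    have := Fact.mk hp
    rcases eq_or_ne p 2 with rfl | hp2
    · exact ⟨6, h36⟩
    have hy : (y : ZMod p) = 0 :=
      (ZMod.intCast_zmod_eq_zero_iff_dvd y p).mpr (Int.natCast_dvd.mpr hpy)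
    have hE : (x : ZMod p) ^ 4 = 17 * (z : ZMod p) ^ 4 := by
      have := congrArg (Int.cast : ℤ → ZMod p) h
      push_cast at this
      rw [hy] at this
      linear_combination -this
    have hz : (z : ZMod p) ≠ 0 := by
      intro hz
      have hx : (x : ZMod p) = 0 := by simpa [hz] using hE
      obtain ⟨u, v, huv⟩ := hxz
      have := congrArg (Int.cast : ℤ → ZMod p) huv
      push_cast at this
      simp [hx, hz] at this
    refine (ZMod.exists_sq_eq_prime_iff_of_mod_four_eq_one (p := 17) (q := p) (by norm_num)
      hp2).mpr ⟨(x : ZMod p) ^ 2 / (z : ZMod p) ^ 2, ?_⟩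
    push_cast
    field_simp
    linear_combination -hE
  obtain ⟨t, ht⟩ := ZMod.isSquare_natCast_of_forall_prime_dvd _ hp
  have hy : (y : ZMod 17) ^ 2 = t ^ 4 := by
    have h1 : ((y.natAbs : ℤ) : ZMod 17) ^ 2 = (y : ZMod 17) ^ 2 := by
      rw [← Int.cast_pow, Int.natAbs_sq, Int.cast_pow]
    rw [← h1, Int.cast_natCast, ht]
    ring
  have hE : 2 * t ^ 4 = (x : ZMod 17) ^ 4 := by
    have := congrArg (Int.cast : ℤ → ZMod 17) h
    push_cast at this
    rw [hy] at this
    rw [this, h0]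
    ring
  obtain ⟨ht0, hx0⟩ := key _ _ hE
  have hy0 : (y : ZMod 17) = 0 := by simpa [ht0] using hy
  obtain ⟨a, ha⟩ := (ZMod.intCast_zmod_eq_zero_iff_dvd x 17).mp hx0
  obtain ⟨b, hb⟩ := (ZMod.intCast_zmod_eq_zero_iff_dvd y 17).mp hy0
  have hz4 : (17 : ℤ) ∣ z ^ 4 := ⟨17 ^ 2 * a ^ 4 - 2 * b ^ 2, by
    push_cast at ha hb
    subst ha hb
    linarith⟩
  have hz : (17 : ℤ) ∣ z := (by norm_num : Prime (17 : ℤ)).dvd_of_dvd_pow hz4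
  have hu : IsUnit (17 : ℤ) := hxz.isUnit_of_dvd' ⟨a, by exact_mod_cast ha⟩ hz
  rw [Int.isUnit_iff] at hu
  omega

/-- The Reichardt–Lind curve has no affine rational point. -/
theorem Rat.two_mul_sq_ne_pow_four_sub (r s : ℚ) : 2 * s ^ 2 ≠ r ^ 4 - 17 := by
  intro h
  have hd : (r.den : ℚ) ≠ 0 := by exact_mod_cast r.den_nz
  have hr : r * r.den = r.num := Rat.mul_den_eq_num r
  have hw : (2 * s * r.den ^ 2) ^ 2 =
      algebraMap ℤ ℚ (2 * (r.num ^ 4 - 17 * (r.den : ℤ) ^ 4)) := by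
    simp only [algebraMap_int_eq, eq_intCast]
    push_cast
    rw [← hr]
    linear_combination 2 * (r.den : ℚ) ^ 4 * h
  obtain ⟨w, hw'⟩ := IsIntegrallyClosed.exists_algebraMap_eq_of_isIntegral_pow (R := ℤ)
    (x := 2 * s * (r.den : ℚ) ^ 2) two_pos (hw ▸ isIntegral_algebraMap)
  rw [← hw', ← map_pow] at hw
  have hw2 : w ^ 2 = 2 * (r.num ^ 4 - 17 * (r.den : ℤ) ^ 4) := by
    simpa using (algebraMap ℤ ℚ).injective_int hw
  obtain ⟨y, rfl⟩ := Int.prime_two.dvd_of_dvd_pow ⟨_, hw2⟩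
  refine two_mul_sq_ne_of_isCoprime (x := r.num) (y := y) (z := r.den) ?_ (by linarith)
  rw [Int.isCoprime_iff_gcd_eq_one]
  simpa [Int.gcd] using r.reduced

open Polynomial in
/-- The norm form `2a² - (X⁴ - 17)b²` of the function field of the Reichardt–Lind curve
is anisotropic at infinity, so its values have the maximal possible degree. -/
theorem two_mul_sq_sub_natDegree {a b : ℚ[X]} (hab : ¬ (a = 0 ∧ b = 0)) :
    2 * a ^ 2 - (X ^ 4 - 17) * b ^ 2 ≠ 0 ∧
      Even (2 * a ^ 2 - (X ^ 4 - 17) * b ^ 2).natDegree := by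
  set f : ℚ[X] := X ^ 4 - 17 with hf
  have hfd : f.natDegree = 4 := by rw [hf]; compute_degree!
  have hfm : f.Monic := by rw [hf]; monicity!
  have h2 : (2 : ℚ[X]) = C 2 := rfl
  have hd1 : (2 * a ^ 2).natDegree = 2 * a.natDegree := by
    rw [h2, natDegree_C_mul two_ne_zero, natDegree_pow]
  have hl1 : (2 * a ^ 2).leadingCoeff = 2 * a.leadingCoeff ^ 2 := by
    rw [h2, leadingCoeff_mul, leadingCoeff_C, leadingCoeff_pow]
  have hl2 : (f * b ^ 2).leadingCoeff = b.leadingCoeff ^ 2 := by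
    rw [leadingCoeff_mul, hfm.leadingCoeff, one_mul, leadingCoeff_pow]
  have hl : 2 * a.leadingCoeff ^ 2 ≠ b.leadingCoeff ^ 2 := by
    intro h
    have ha := Rat.two_mul_sq_ne_sq h
    have hb : b.leadingCoeff = 0 := by simpa [ha] using h.symm
    exact hab ⟨leadingCoeff_eq_zero.mp ha, leadingCoeff_eq_zero.mp hb⟩
  refine ⟨fun h => hl ?_, ?_⟩
  · rw [← hl1, ← hl2, sub_eq_zero.mp h]
  rcases eq_or_ne b 0 with rfl | hb
  · simp [hd1]
  have hd2 : (f * b ^ 2).natDegree = 4 + 2 * b.natDegree := by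
    rw [hfm.natDegree_mul' (pow_ne_zero 2 hb), natDegree_pow, hfd]
  rcases lt_trichotomy (2 * a ^ 2).natDegree (f * b ^ 2).natDegree with hlt | heq | hgt
  · rw [natDegree_sub_eq_right_of_natDegree_lt hlt, hd2]
    exact ⟨2 + b.natDegree, by ring⟩
  · have : (2 * a ^ 2 - f * b ^ 2).natDegree = (2 * a ^ 2).natDegree := by
      refine natDegree_eq_of_le_of_coeff_ne_zero
        ((natDegree_sub_le _ _).trans (max_le le_rfl heq.ge)) ?_
      rw [coeff_sub, sub_ne_zero, coeff_natDegree, heq, coeff_natDegree, hl1, hl2]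
      exact hl
    rw [this, hd1]
    exact even_two_mul _
  · rw [natDegree_sub_eq_left_of_natDegree_lt hgt, hd1]
    exact even_two_mul _

open Polynomial in
/-- If `θ` generates an extension of odd degree, it is not the abscissa of a point of the
Reichardt–Lind curve: by Riemann–Roch such a point would yield a rational one. -/
theorem two_mul_sq_ne_of_natDegree_minpoly_eq {F : Type*} [Field F] [Algebra ℚ F]
    [FiniteDimensional ℚ F] (hodd : Odd (Module.finrank ℚ F)) {θ : F}
    (hθ : (minpoly ℚ θ).natDegree = Module.finrank ℚ F) (η : F) :
    2 * η ^ 2 ≠ θ ^ 4 - 17 := by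
  intro h
  have hInt : IsIntegral ℚ θ := Algebra.IsIntegral.isIntegral θ
  have hrat : (minpoly ℚ θ).degree ≠ 1 := by
    intro hdeg
    obtain ⟨r, rfl⟩ := minpoly.mem_range_of_degree_eq_one ℚ θ hdeg
    obtain ⟨s, rfl⟩ := exists_algebraMap_eq_of_sq_eq_of_odd_finrank hodd (y := η)
      (c := (r ^ 4 - 17) / 2) (by
        have h2 : (2 : F) ≠ 0 := by
          simpa using (algebraMap ℚ F).injective.ne (two_ne_zero (α := ℚ))
        simp only [map_div₀, map_sub, map_pow, map_ofNat]
        rw [eq_div_iff h2, ← h]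
        ring)
    refine Rat.two_mul_sq_ne_pow_four_sub r s ((algebraMap ℚ F).injective ?_)
    simpa only [map_mul, map_sub, map_pow, map_ofNat] using h
  obtain ⟨k, hk⟩ := hodd
  let φ : (degreeLT ℚ (k + 2) × degreeLT ℚ k) →ₗ[ℚ] F :=
    ((aeval θ).toLinearMap ∘ₗ (degreeLT ℚ (k + 2)).subtype).coprod
      (-(LinearMap.mulLeft ℚ η ∘ₗ (aeval θ).toLinearMap ∘ₗ (degreeLT ℚ k).subtype))
  have hfin : ∀ n : ℕ, FiniteDimensional ℚ (degreeLT ℚ n) := fun n =>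
    (degreeLTEquiv ℚ n).symm.finiteDimensional
  have hrank : ∀ n : ℕ, Module.finrank ℚ (degreeLT ℚ n) = n := fun n => by
    simpa using (degreeLTEquiv ℚ n).finrank_eq
  have hker : LinearMap.ker φ ≠ ⊥ := by
    apply LinearMap.ker_ne_bot_of_finrank_lt
    rw [Module.finrank_prod, hrank, hrank, hk]
    omega
  obtain ⟨⟨⟨a, ha⟩, ⟨b, hb⟩⟩, hmem, hne⟩ := Submodule.exists_mem_ne_zero_of_ne_bot hker
  have hab : ¬ (a = 0 ∧ b = 0) := by
    rintro ⟨rfl, rfl⟩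
    exact hne rfl
  have hrel : aeval θ a = η * aeval θ b := by
    have : aeval θ a + -(η * aeval θ b) = 0 := hmem
    linear_combination this
  obtain ⟨hN0, hNeven⟩ := two_mul_sq_sub_natDegree hab
  have hNdeg : (2 * a ^ 2 - (X ^ 4 - 17) * b ^ 2).natDegree ≤ 2 * k + 2 := by
    have ha' : a.natDegree ≤ k + 1 := by
      rcases eq_or_ne a 0 with rfl | h0
      · simp
      · have := (natDegree_lt_iff_degree_lt h0).mpr (mem_degreeLT.mp ha)
        omega
    have h2 : (2 : ℚ[X]) = C 2 := rfl
    refine (natDegree_sub_le _ _).trans (max_le ?_ ?_)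
    · rw [h2, natDegree_C_mul two_ne_zero, natDegree_pow]
      omega
    · rcases eq_or_ne b 0 with rfl | h0
      · simp
      · have := (natDegree_lt_iff_degree_lt h0).mpr (mem_degreeLT.mp hb)
        have hf : (X ^ 4 - 17 : ℚ[X]).natDegree = 4 := by compute_degree!
        refine natDegree_mul_le.trans ?_
        rw [hf, natDegree_pow]
        omega
  obtain ⟨q, hq⟩ : minpoly ℚ θ ∣ 2 * a ^ 2 - (X ^ 4 - 17) * b ^ 2 := by
    apply minpoly.dvd
    simp only [map_sub, map_mul, map_pow, map_ofNat, aeval_X, hrel, ← h]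
    ring
  have hq0 : q ≠ 0 := by
    rintro rfl
    exact hN0 (by rw [hq, mul_zero])
  have hqd : q.natDegree = 1 := by
    rw [hq, natDegree_mul (minpoly.ne_zero hInt) hq0, hθ, hk] at hNdeg hNeven
    obtain ⟨j, hj⟩ := hNeven
    omega
  obtain ⟨α, hα, β, rfl⟩ := natDegree_eq_one.mp hqd
  set r : ℚ := -β / α with hr
  have hroot : α * r + β = 0 := by rw [hr]; field_simp; ring
  have hev : 2 * a.eval r ^ 2 = (r ^ 4 - 17) * b.eval r ^ 2 := by
    have := congrArg (eval r) hq
    simp only [eval_sub, eval_mul, eval_pow, eval_add, eval_C, eval_X, eval_ofNat, hroot] at this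
    linear_combination this
  rcases eq_or_ne (b.eval r) 0 with hbr | hbr
  · have har : a.eval r = 0 := by simpa [hbr] using hev
    have hder := congrArg (fun g => eval r (derivative g)) hq
    simp [har, hbr, hroot, derivative_pow, hα] at hder
    exact hrat (degree_eq_one_of_irreducible_of_root (minpoly.irreducible hInt) hder)
  · refine Rat.two_mul_sq_ne_pow_four_sub r (a.eval r / b.eval r) ?_
    field_simp
    linear_combination hev

/-- The Reichardt–Lind curve has no point in any number field of odd degree:
over such a field `K`, the only solution of `2y² = x⁴ − 17z⁴` is trivial. -/
theorem reichardt_lind_no_odd_degree_point (K : Type*) [Field K] [NumberField K]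
    (hodd : Odd (Module.finrank ℚ K)) :
    ∀ x y z : K, 2 * y ^ 2 = x ^ 4 - 17 * z ^ 4 → x = 0 ∧ y = 0 ∧ z = 0 := by
  intro x y z h
  rcases eq_or_ne z 0 with rfl | hz
  · have hy : y = 0 := by
      by_contra hy
      obtain ⟨d, hd⟩ := exists_algebraMap_eq_of_sq_eq_of_odd_finrank hodd
        (y := x ^ 2 / y) (c := 2) (by
          rw [map_ofNat]
          field_simp
          linear_combination -h)
      have hd2 : 2 * 1 ^ 2 = d ^ 2 := by
        apply (algebraMap ℚ K).injective
        rw [map_pow, hd]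
        simp only [map_mul, map_pow, map_ofNat, map_one]
        field_simp
        linear_combination h
      exact one_ne_zero (Rat.two_mul_sq_ne_sq hd2)
    subst hy
    have hx : x = 0 := by simpa using h.symm
    exact ⟨hx, rfl, rfl⟩
  · exfalso
    have hpt : 2 * (y / z ^ 2) ^ 2 = (x / z) ^ 4 - 17 := by
      field_simp
      linear_combination h
    generalize y / z ^ 2 = η at hpt
    generalize x / z = θ at hpt
    let F := IntermediateField.adjoin ℚ {θ}
    let θ' : F := IntermediateField.AdjoinSimple.gen ℚ θ
    have hθ' : algebraMap F K θ' = θ := IntermediateField.AdjoinSimple.algebraMap_gen ℚ θ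
    have hmul := Module.finrank_mul_finrank ℚ F K
    rw [← hmul, Nat.odd_mul] at hodd
    obtain ⟨η', hη'⟩ := exists_algebraMap_eq_of_sq_eq_of_odd_finrank hodd.2
      (y := η) (c := (θ' ^ 4 - 17) / 2) (by
        simp only [map_div₀, map_sub, map_pow, map_ofNat, hθ']
        rw [← hpt]
        ring)
    have hInt : IsIntegral ℚ θ := Algebra.IsIntegral.isIntegral θ
    refine two_mul_sq_ne_of_natDegree_minpoly_eq hodd.1 (θ := θ') ?_ η' ?_
    · have hfr : Module.finrank ℚ F = (minpoly ℚ θ).natDegree :=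
        IntermediateField.adjoin.finrank hInt
      rw [← hθ', minpoly.algebraMap_eq (algebraMap F K).injective] at hfr
      exact hfr.symm
    · apply (algebraMap F K).injective
      simpa only [map_mul, map_sub, map_pow, map_ofNat, hθ', hη'] using hpt
end
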